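/- Let k be a field, n ≥ 0, and X a cochain complex of k-vector spaces. Consider the Hom complex Hom•(L^n, X), with Hom^m(L^n, X) = ∏_{p} Hom_k((L^n)^p, X^{p+m}) and differential D(φ) = d_X ∘ φ − (−1)^m φ ∘ d_{L^n} for φ of degree m. Define r : X → Hom•(L^n, X) by sending x ∈ X^m to the degree-m map with r(x)(f_i) = x for every vertex i and r(x)(f_{i_0<…<i_p}) = 0 for p ≥ 1. Then r is a chain map and a quasi-isomorphism: it induces an isomorphism on cohomology in every degree. -/

import Mathlib

open scoped TensorProduct

/-- Index set for the basis of `L^n`: strictly increasing tuples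
`0 ≤ i₀ < … < i_p ≤ n`, encoded as nonempty subsets of `{0,…,n}`. -/
abbrev SimplexIdx (n : ℕ) := {S : Finset (Fin (n + 1)) // S.Nonempty}

/-- `L^n`: the free vector space on the nonempty faces of the `n`-simplex. -/
abbrev L (k : Type) [Field k] (n : ℕ) := SimplexIdx n →₀ k

/-- The basis element `f_{i₀<…<i_p}`. -/
noncomputable def fbas (k : Type) [Field k] (n : ℕ) (S : SimplexIdx n) : L k n :=
  Finsupp.single S 1

/-- The Moore differential: `d f_{i₀<…<i_p} = ∑_j (-1)^j f_{i₀<…<î_j<…<i_p}` for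
`p ≥ 1` and `d f_{i₀} = 0`.  The `j`-th element of `S` has exactly `j` smaller
elements in `S`, so the sign of dropping `x ∈ S` is `(-1)^#{y ∈ S | y < x}`. -/
noncomputable def dL (k : Type) [Field k] (n : ℕ) : L k n →ₗ[k] L k n :=
  Finsupp.lift (L k n) k (SimplexIdx n) (fun S =>
    if h : 2 ≤ S.1.card then
      ∑ x ∈ S.1.attach,
        ((-1 : k) ^ (S.1.filter (· < x.1)).card) •
          Finsupp.single (⟨S.1.erase x.1,
            Finset.card_pos.mp (by rw [Finset.card_erase_of_mem x.2]; omega)⟩ : SimplexIdx n) 1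
    else 0)

/-- The comultiplication `Δ f_{i₀<…<i_p} = ∑_j f_{i₀<…<i_j} ⊗ f_{i_j<…<i_p}`. -/
noncomputable def comulL (k : Type) [Field k] (n : ℕ) : L k n →ₗ[k] (L k n ⊗[k] L k n) :=
  Finsupp.lift (L k n ⊗[k] L k n) k (SimplexIdx n) (fun S =>
    ∑ x ∈ S.1.attach,
      (Finsupp.single (⟨S.1.filter (· ≤ x.1),
          ⟨x.1, Finset.mem_filter.mpr ⟨x.2, le_refl _⟩⟩⟩ : SimplexIdx n) (1 : k)) ⊗ₜ[k]
      (Finsupp.single (⟨S.1.filter (x.1 ≤ ·),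
          ⟨x.1, Finset.mem_filter.mpr ⟨x.2, le_refl _⟩⟩⟩ : SimplexIdx n) (1 : k)))

/-- The counit `ε`: `ε f_i = 1` on vertices, `ε f_{i₀<…<i_p} = 0` for `p ≥ 1`. -/
noncomputable def epsL (k : Type) [Field k] (n : ℕ) : L k n →ₗ[k] k :=
  Finsupp.lift k k (SimplexIdx n) (fun S => if S.1.card = 1 then 1 else 0)


/-- The degree `p` graded piece of `L^n`. -/
noncomputable def Lgrade (k : Type) [Field k] (n : ℕ) (p : ℤ) : Submodule k (L k n) :=
  Submodule.span k {v | ∃ S : SimplexIdx n, (S.1.card : ℤ) = 1 - p ∧ v = Finsupp.single S 1}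

/-- The map `r : X → Hom•(L^n, X)`: `x` goes to the map with `r(x)(f_i) = x`
on vertices and `r(x)(f_{i₀<…<i_p}) = 0` for `p ≥ 1`. -/
noncomputable def rmap (k : Type) [Field k] (X : Type) [AddCommGroup X] [Module k X]
    (n : ℕ) (x : X) : L k n →ₗ[k] X :=
  Finsupp.lift X k (SimplexIdx n) (fun S => if S.1.card = 1 then x else 0)

/-!
STATEMENT 11: For a cochain complex `X` of `k`-vector spaces (an ambient
module `X` with grading `𝒳 : ℤ → Submodule k X`, forming a direct sum
decomposition, and differential `dX` of degree `+1` squaring to zero),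
consider the Hom complex `Hom•(L^n, X)`: a map `φ : L^n → X` has degree `m`
if `φ((L^n)^p) ⊆ X^(p+m)` for all `p`, and the differential of a degree-`m`
map is `D(φ) = dX ∘ φ - (-1)^m • (φ ∘ d_{L^n})`.  Then
`r : X → Hom•(L^n, X)` is a chain map sending `X^m` into the degree-`m` maps,
and it is a quasi-isomorphism: it induces an isomorphism on cohomology in
every degree.
-/

/-- The basis element of `L^n` attached to a finite set of vertices, with value `0` on `∅`. -/
noncomputable def face (k : Type) [Field k] (n : ℕ) (S : Finset (Fin (n + 1))) : L k n :=
  if h : S.Nonempty then Finsupp.single ⟨S, h⟩ 1 else 0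

/-- The cone operator with apex the vertex `0`: `f_S ↦ f_{{0} ∪ S}` if `0 ∉ S`, else `0`. -/
noncomputable def coneL (k : Type) [Field k] (n : ℕ) : L k n →ₗ[k] L k n :=
  Finsupp.lift (L k n) k (SimplexIdx n) (fun S => if 0 ∈ S.1 then 0 else face k n (insert 0 S.1))

section

variable {k : Type} [Field k] {n : ℕ}

lemma face_coe (S : SimplexIdx n) : face k n S.1 = Finsupp.single S 1 := by
  simp [face, S.2]

lemma face_empty : face k n ∅ = 0 := by
  simp [face]

lemma linearMap_ext_face {M : Type*} [AddCommGroup M] [Module k M] {f g : L k n →ₗ[k] M}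
    (h : ∀ S : Finset (Fin (n + 1)), S.Nonempty → f (face k n S) = g (face k n S)) : f = g := by
  refine Finsupp.lhom_ext' fun S => LinearMap.ext_ring ?_
  simpa [face_coe] using h S.1 S.2

lemma dL_face (S : Finset (Fin (n + 1))) :
    dL k n (face k n S) =
      ∑ x ∈ S, ((-1 : k) ^ (S.filter (· < x)).card) • face k n (S.erase x) := by
  by_cases hS : S.Nonempty
  · rw [← Finset.sum_attach]
    rw [face, dif_pos hS, dL, Finsupp.lift_apply, Finsupp.sum_single_index (by simp), one_smul]
    split_ifs with h
    · refine Finset.sum_congr rfl fun x _ => ?_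
      congr 1
      exact (face_coe _).symm
    · refine (Finset.sum_eq_zero fun x _ => ?_).symm
      have hc : (S.erase x.1).card = 0 := by
        rw [Finset.card_erase_of_mem x.2]
        dsimp only at h
        omega
      rw [Finset.card_eq_zero.mp hc, face_empty, smul_zero]
  · rw [Finset.not_nonempty_iff_eq_empty.mp hS]
    simp [face_empty]

lemma coneL_face_of_mem {S : Finset (Fin (n + 1))} (h : 0 ∈ S) :
    coneL k n (face k n S) = 0 := by
  rw [face, dif_pos ⟨0, h⟩, coneL, Finsupp.lift_apply, Finsupp.sum_single_index (by simp)]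
  simp [h]

lemma coneL_face_of_notMem {S : Finset (Fin (n + 1))} (hS : S.Nonempty) (h : 0 ∉ S) :
    coneL k n (face k n S) = face k n (insert 0 S) := by
  rw [face, dif_pos hS, coneL, Finsupp.lift_apply, Finsupp.sum_single_index (by simp)]
  simp [h]

lemma rmap_face {X : Type} [AddCommGroup X] [Module k X] (x : X) (S : Finset (Fin (n + 1))) :
    rmap k X n x (face k n S) = if S.card = 1 then x else 0 := by
  by_cases hS : S.Nonempty
  · rw [face, dif_pos hS, rmap, Finsupp.lift_apply, Finsupp.sum_single_index (by simp), one_smul]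
  · rw [Finset.not_nonempty_iff_eq_empty.mp hS]
    simp [face_empty]

lemma filter_lt_insert_zero {S : Finset (Fin (n + 1))} (h : 0 ∉ S) {x : Fin (n + 1)}
    (hx : x ∈ S) :
    ((insert 0 S).filter (· < x)).card = (S.filter (· < x)).card + 1 := by
  have hx0 : 0 < x := Fin.pos_iff_ne_zero.mpr fun e => h (e ▸ hx)
  rw [Finset.filter_insert, if_pos hx0, Finset.card_insert_of_notMem (by simp [h])]

/-- The cone operator is a chain homotopy from the projection onto the vertex `0` to the
identity. -/
lemma dL_coneL_add_coneL_dL :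
    dL k n ∘ₗ coneL k n + coneL k n ∘ₗ dL k n =
      LinearMap.id - rmap k (L k n) n (face k n {0}) := by
  refine linearMap_ext_face fun S hS => ?_
  simp only [LinearMap.add_apply, LinearMap.comp_apply, LinearMap.sub_apply, LinearMap.id_apply,
    rmap_face]
  by_cases h0 : 0 ∈ S
  · obtain ⟨T, hT, rfl⟩ : ∃ T : Finset (Fin (n + 1)), 0 ∉ T ∧ S = insert 0 T :=
      ⟨S.erase 0, by simp, (Finset.insert_erase h0).symm⟩
    rw [coneL_face_of_mem h0, map_zero, zero_add, dL_face, map_sum, Finset.sum_insert hT,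
      Finset.sum_eq_zero (s := T), add_zero]
    · rw [Finset.erase_insert hT, Finset.card_insert_of_notMem hT]
      rcases T.eq_empty_or_nonempty with rfl | hne
      · simp [face_empty]
      · have := hne.card_pos
        rw [map_smul, coneL_face_of_notMem hne hT, if_neg (by omega)]
        simp
    · intro x hx
      have hx0 : (0 : Fin (n + 1)) ≠ x := fun e => hT (e ▸ hx)
      rw [map_smul, coneL_face_of_mem (by simp [hx0]), smul_zero]
  · rw [coneL_face_of_notMem hS h0, dL_face, dL_face, map_sum, Finset.sum_insert h0,
      Finset.erase_insert h0, add_assoc, ← Finset.sum_add_distrib]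
    by_cases hc : S.card = 1
    · obtain ⟨i, rfl⟩ := Finset.card_eq_one.mp hc
      have hi : (0 : Fin (n + 1)) ≠ i := by simpa using h0
      rw [Finset.sum_singleton, filter_lt_insert_zero h0 (Finset.mem_singleton_self i),
        Finset.erase_insert_of_ne hi]
      simp [face_empty, sub_eq_add_neg, Finset.filter_singleton]
    · rw [if_neg hc, Finset.sum_eq_zero]
      · simp
      · intro x hx
        have hx0 : (0 : Fin (n + 1)) ≠ x := fun e => h0 (e ▸ hx)
        have hpos := hS.card_pos
        have hne : (S.erase x).Nonempty := by
          rw [← Finset.card_pos, Finset.card_erase_of_mem hx]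
          omega
        rw [map_smul, coneL_face_of_notMem hne (by simp [h0]), filter_lt_insert_zero h0 hx,
          Finset.erase_insert_of_ne hx0, pow_succ, mul_neg_one, neg_smul, neg_add_cancel]

lemma rmap_comp_dL {X : Type} [AddCommGroup X] [Module k X] (x : X) :
    rmap k X n x ∘ₗ dL k n = 0 := by
  refine linearMap_ext_face fun S hS => ?_
  rw [LinearMap.comp_apply, dL_face, map_sum, LinearMap.zero_apply]
  by_cases hc : S.card = 2
  · have key : ∀ a b : Fin (n + 1), a < b →
        ∑ y ∈ ({a, b} : Finset (Fin (n + 1))), rmap k X n x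
          (((-1 : k) ^ ((({a, b} : Finset (Fin (n + 1))).filter (· < y)).card)) •
            face k n (({a, b} : Finset (Fin (n + 1))).erase y)) = 0 := by
      intro a b hab
      have hne : a ≠ b := hab.ne
      have ha : (({a, b} : Finset (Fin (n + 1))).filter (· < a)) = ∅ := by
        ext y; simp; grind
      have hb : (({a, b} : Finset (Fin (n + 1))).filter (· < b)) = {a} := by
        ext y; simp; grind
      rw [Finset.sum_pair hne, ha, hb, map_smul, map_smul, rmap_face, rmap_face,
        Finset.card_erase_of_mem (by simp), Finset.card_erase_of_mem (by simp),
        Finset.card_pair hne]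
      simp
    obtain ⟨a, b, hab, rfl⟩ := Finset.card_eq_two.mp hc
    rcases hab.lt_or_gt with h | h
    · exact key a b h
    · rw [Finset.pair_comm]
      exact key b a h
  · refine Finset.sum_eq_zero fun y hy => ?_
    have hpos := hS.card_pos
    rw [map_smul, rmap_face, Finset.card_erase_of_mem hy, if_neg (by omega), smul_zero]

lemma face_mem_Lgrade {S : Finset (Fin (n + 1))} {p : ℤ} (hp : (S.card : ℤ) = 1 - p) :
    face k n S ∈ Lgrade k n p := by
  by_cases hS : S.Nonempty
  · exact Submodule.subset_span ⟨⟨S, hS⟩, hp, by rw [← face_coe]⟩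
  · rw [Finset.not_nonempty_iff_eq_empty.mp hS, face_empty]
    exact zero_mem _

lemma map_mem_of_mem_Lgrade {M : Type*} [AddCommGroup M] [Module k M] {f : L k n →ₗ[k] M}
    {N : Submodule k M} {p : ℤ}
    (h : ∀ S : Finset (Fin (n + 1)), S.Nonempty → (S.card : ℤ) = 1 - p → f (face k n S) ∈ N)
    {v : L k n} (hv : v ∈ Lgrade k n p) : f v ∈ N := by
  have hle : Lgrade k n p ≤ N.comap f := by
    refine Submodule.span_le.mpr ?_
    rintro _ ⟨S, hS, rfl⟩
    rw [← face_coe]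
    exact h S.1 S.2 hS
  exact hle hv

lemma coneL_mem_Lgrade {p : ℤ} {v : L k n} (hv : v ∈ Lgrade k n p) :
    coneL k n v ∈ Lgrade k n (p - 1) := by
  refine map_mem_of_mem_Lgrade (fun S hne hS => ?_) hv
  by_cases h0 : 0 ∈ S
  · rw [coneL_face_of_mem h0]
    exact zero_mem _
  · rw [coneL_face_of_notMem hne h0]
    refine face_mem_Lgrade ?_
    rw [Finset.card_insert_of_notMem h0]
    push_cast
    omega

lemma map_comp_rmap {X Y : Type} [AddCommGroup X] [Module k X] [AddCommGroup Y] [Module k Y]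
    (f : X →ₗ[k] Y) (x : X) : f ∘ₗ rmap k X n x = rmap k Y n (f x) := by
  refine linearMap_ext_face fun S _ => ?_
  rw [LinearMap.comp_apply, rmap_face, rmap_face, apply_ite f, map_zero]

lemma dL_face_singleton (i : Fin (n + 1)) : dL k n (face k n {i}) = 0 := by
  simp [dL_face, face_empty]

end

theorem rmap_is_quasi_isomorphism (k : Type) [Field k] (n : ℕ)
    (X : Type) [AddCommGroup X] [Module k X]
    (𝒳 : ℤ → Submodule k X) [DirectSum.Decomposition 𝒳]
    (dX : X →ₗ[k] X)
    (hdX_mem : ∀ (i : ℤ), ∀ x ∈ 𝒳 i, dX x ∈ 𝒳 (i + 1))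
    (hdX_sq : ∀ x : X, dX (dX x) = 0) :
    -- r sends X^m to degree-m maps and is a chain map: D(r x) = r (dX x)
    (∀ (m : ℤ), ∀ x ∈ 𝒳 m,
      (∀ (p : ℤ), ∀ v ∈ Lgrade k n p, rmap k X n x v ∈ 𝒳 (p + m)) ∧
      dX ∘ₗ rmap k X n x - ((Int.negOnePow m : ℤ)) • (rmap k X n x ∘ₗ dL k n) =
        rmap k X n (dX x)) ∧
    -- r is injective on cohomology
    (∀ (m : ℤ), ∀ x ∈ 𝒳 m, dX x = 0 →
      (∃ ψ : L k n →ₗ[k] X,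
        (∀ (p : ℤ), ∀ v ∈ Lgrade k n p, ψ v ∈ 𝒳 (p + (m - 1))) ∧
        dX ∘ₗ ψ - ((Int.negOnePow (m - 1) : ℤ)) • (ψ ∘ₗ dL k n) = rmap k X n x) →
      ∃ y ∈ 𝒳 (m - 1), dX y = x) ∧
    -- r is surjective on cohomology
    (∀ (m : ℤ) (φ : L k n →ₗ[k] X),
      (∀ (p : ℤ), ∀ v ∈ Lgrade k n p, φ v ∈ 𝒳 (p + m)) →
      dX ∘ₗ φ - ((Int.negOnePow m : ℤ)) • (φ ∘ₗ dL k n) = 0 →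
      ∃ x ∈ 𝒳 m, dX x = 0 ∧
        ∃ ψ : L k n →ₗ[k] X,
          (∀ (p : ℤ), ∀ v ∈ Lgrade k n p, ψ v ∈ 𝒳 (p + (m - 1))) ∧
          rmap k X n x - φ =
            dX ∘ₗ ψ - ((Int.negOnePow (m - 1) : ℤ)) • (ψ ∘ₗ dL k n)) := by
  have hvertex : face k n {0} ∈ Lgrade k n 0 := face_mem_Lgrade (by simp)
  refine ⟨fun m x hx => ⟨fun p v hv => ?_, ?_⟩, ?_, ?_⟩
  · refine map_mem_of_mem_Lgrade (fun S _ hS => ?_) hv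
    rw [rmap_face]
    split_ifs with hc
    · obtain rfl : p = 0 := by omega
      rwa [zero_add]
    · exact zero_mem _
  · rw [rmap_comp_dL, smul_zero, sub_zero, map_comp_rmap]
  · rintro m x - - ⟨ψ, hψ, h⟩
    refine ⟨ψ (face k n {0}), by simpa using hψ 0 _ hvertex, ?_⟩
    simpa [dL_face_singleton, rmap_face] using LinearMap.congr_fun h (face k n {0})
  · intro m φ hφ h
    refine ⟨φ (face k n {0}), by simpa using hφ 0 _ hvertex, ?_,
      ((Int.negOnePow (m - 1) : ℤ)) • (φ ∘ₗ coneL k n), fun p v hv => ?_, ?_⟩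
    · simpa [dL_face_singleton] using LinearMap.congr_fun h (face k n {0})
    · have := hφ _ _ (coneL_mem_Lgrade hv)
      rw [show p + (m - 1) = p - 1 + m by ring]
      exact zsmul_mem this _
    · rw [sub_eq_zero] at h
      have hcone : φ ∘ₗ dL k n ∘ₗ coneL k n + φ ∘ₗ coneL k n ∘ₗ dL k n =
          φ - rmap k X n (φ (face k n {0})) := by
        rw [← LinearMap.comp_add, dL_coneL_add_coneL_dL, LinearMap.comp_sub, LinearMap.comp_id,
          map_comp_rmap]
      have hd : dX ∘ₗ φ ∘ₗ coneL k n =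
          ((Int.negOnePow m : ℤ)) • (φ ∘ₗ dL k n ∘ₗ coneL k n) := by
        rw [← LinearMap.comp_assoc, h]
        rfl
      rw [← neg_sub φ, ← hcone]
      have hcomp : dX ∘ₗ (((Int.negOnePow (m - 1) : ℤ)) • (φ ∘ₗ coneL k n)) =
          ((Int.negOnePow (m - 1) : ℤ)) • (dX ∘ₗ φ ∘ₗ coneL k n) := by
        ext; simp
      have hcomp' : (((Int.negOnePow (m - 1) : ℤ)) • (φ ∘ₗ coneL k n)) ∘ₗ dL k n =
          ((Int.negOnePow (m - 1) : ℤ)) • (φ ∘ₗ coneL k n ∘ₗ dL k n) := rfl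
      rw [hcomp, hcomp', hd]
      rcases Int.even_or_odd m with hm | hm
      · rw [Int.negOnePow_even m hm, Int.negOnePow_odd (m - 1) (hm.sub_odd odd_one)]
        simp
        abel
      · rw [Int.negOnePow_odd m hm, Int.negOnePow_even (m - 1) (hm.sub_odd odd_one)]
        simp
        abel
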